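/- Let (J^ℱ,(f_n)) and (J^𝒢,(g_n)) be two unimodal nonautonomous discrete dynamical systems with the same kneading sequence, and assume that (J^𝒢,(g_n)) satisfies the limit property. If there exists a unimodal map f:J^ℱ→J^ℱ whose turning point c^f is not periodic, such that 𝒞(f)={x∈J^ℱ : f^ℓ(x)=c^f for some ℓ≥0} is dense in J^ℱ and f_n converges uniformly to f, then (J^ℱ,(f_n)) and (J^𝒢,(g_n)) are topologically semi-conjugate: there exists an equicontinuous sequence (h_n)_{n≥1} of order-preserving continuous surjective maps h_n:J^ℱ→J^𝒢 with h_{n+1}∘f_n=g_n∘h_n for every n≥1. -/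

import Mathlib

open Set

noncomputable section

/-- The nonautonomous iterate `f_n^ℓ = f_{n+ℓ-1} ∘ ⋯ ∘ f_n` (and `f_n^0 = id`). -/
def iterFrom (f : ℕ → ℝ → ℝ) : ℕ → ℕ → ℝ → ℝ
  | _, 0, x => x
  | n, ℓ + 1, x => f (n + ℓ) (iterFrom f n ℓ x)

/-- `(Icc a b, (f n))` is a unimodal nonautonomous discrete dynamical system with
turning points `c n`. -/
def IsUNDS (a b : ℝ) (f : ℕ → ℝ → ℝ) (c : ℕ → ℝ) : Prop :=
  a < b ∧ ∀ n : ℕ,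
    ContinuousOn (f n) (Icc a b) ∧
    MapsTo (f n) (Icc a b) (Icc a b) ∧
    f n a = a ∧ f n b = a ∧
    c n ∈ Ioo a b ∧
    StrictMonoOn (f n) (Icc a (c n)) ∧
    StrictAntiOn (f n) (Icc (c n) b)

/-- The two systems have the same kneading sequence. -/
def SameKneading (f : ℕ → ℝ → ℝ) (cF : ℕ → ℝ) (g : ℕ → ℝ → ℝ) (cG : ℕ → ℝ) : Prop :=
  ∀ n ℓ : ℕ,
    (iterFrom f n ℓ (cF n) < cF (n + ℓ) ↔ iterFrom g n ℓ (cG n) < cG (n + ℓ)) ∧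
    (iterFrom f n ℓ (cF n) = cF (n + ℓ) ↔ iterFrom g n ℓ (cG n) = cG (n + ℓ))

/-- `𝒞_n(ℱ)`: points of `Icc a b` eventually mapped onto a turning point. -/
def critSet (a b : ℝ) (f : ℕ → ℝ → ℝ) (c : ℕ → ℝ) (n : ℕ) : Set ℝ :=
  {x ∈ Icc a b | ∃ ℓ : ℕ, iterFrom f n ℓ x = c (n + ℓ)}

/-- A (single) unimodal map on `Icc a b` with turning point `cg`. -/
def IsUnimodal (a b : ℝ) (g : ℝ → ℝ) (cg : ℝ) : Prop :=
  ContinuousOn g (Icc a b) ∧ MapsTo g (Icc a b) (Icc a b) ∧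
  g a = a ∧ g b = a ∧ cg ∈ Ioo a b ∧
  StrictMonoOn g (Icc a cg) ∧ StrictAntiOn g (Icc cg b)

/-- `𝒞(g)` for an autonomous unimodal map `g`. -/
def critSetMap (a b : ℝ) (g : ℝ → ℝ) (cg : ℝ) : Set ℝ :=
  {x ∈ Icc a b | ∃ ℓ : ℕ, g^[ℓ] x = cg}

/-- The limit property for a UNDS. -/
def LimitProperty (a b : ℝ) (f : ℕ → ℝ → ℝ) (c : ℕ → ℝ) : Prop :=
  ∃ (g : ℝ → ℝ) (cg : ℝ),
    IsUnimodal a b g cg ∧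
    (∀ m : ℕ, 1 ≤ m → g^[m] cg ≠ cg) ∧
    TendstoUniformlyOn (fun n => f n) g Filter.atTop (Icc a b) ∧
    (∀ n : ℕ, Icc a b ⊆ closure (critSet a b f c n)) ∧
    Icc a b ⊆ closure (critSetMap a b g cg)

theorem iterFrom_succ' (f : ℕ → ℝ → ℝ) (n ℓ : ℕ) (x : ℝ) :
    iterFrom f n (ℓ + 1) x = iterFrom f (n + 1) ℓ (f n x) := by
  induction ℓ with
  | zero => rfl
  | succ ℓ ih =>
    rw [iterFrom, ih, iterFrom]
    congr 1
    omega

theorem iterFrom_add (f : ℕ → ℝ → ℝ) (n k j : ℕ) (x : ℝ) :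
    iterFrom f n (k + j) x = iterFrom f (n + k) j (iterFrom f n k x) := by
  induction j with
  | zero => rfl
  | succ j ih => rw [← add_assoc, iterFrom, ih, iterFrom, add_assoc]

theorem iterFrom_const (g : ℝ → ℝ) (n ℓ : ℕ) (x : ℝ) :
    iterFrom (fun _ => g) n ℓ x = g^[ℓ] x := by
  induction ℓ with
  | zero => rfl
  | succ ℓ ih => rw [iterFrom, ih, Function.iterate_succ_apply']

namespace IsUNDS

variable {a b : ℝ} {f : ℕ → ℝ → ℝ} {c : ℕ → ℝ}

theorem mapsTo_iterFrom (hF : IsUNDS a b f c) (n ℓ : ℕ) :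
    MapsTo (iterFrom f n ℓ) (Icc a b) (Icc a b) := by
  induction ℓ with
  | zero => exact fun x hx => hx
  | succ ℓ ih => exact fun x hx => (hF.2 (n + ℓ)).2.1 (ih hx)

theorem continuousOn_iterFrom (hF : IsUNDS a b f c) (n ℓ : ℕ) :
    ContinuousOn (iterFrom f n ℓ) (Icc a b) := by
  induction ℓ with
  | zero => exact continuousOn_id
  | succ ℓ ih => exact (hF.2 (n + ℓ)).1.comp ih (hF.mapsTo_iterFrom n ℓ)

theorem iterFrom_left (hF : IsUNDS a b f c) (n ℓ : ℕ) : iterFrom f n ℓ a = a := by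
  induction ℓ with
  | zero => rfl
  | succ ℓ ih => rw [iterFrom, ih, (hF.2 (n + ℓ)).2.2.1]

theorem iterFrom_succ_right (hF : IsUNDS a b f c) (n ℓ : ℕ) : iterFrom f n (ℓ + 1) b = a := by
  rw [iterFrom_succ', (hF.2 n).2.2.2.1, hF.iterFrom_left]

theorem turning_mem (hF : IsUNDS a b f c) (n : ℕ) : c n ∈ Icc a b :=
  Ioo_subset_Icc_self (hF.2 n).2.2.2.2.1

theorem apply_lt_apply_turning (hF : IsUNDS a b f c) {n : ℕ} {x : ℝ} (hx : x ∈ Icc a b)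
    (hxc : x ≠ c n) : f n x < f n (c n) := by
  obtain ⟨-, -, -, -, hc, hm, ha⟩ := hF.2 n
  rcases lt_or_gt_of_ne hxc with h | h
  · exact hm ⟨hx.1, h.le⟩ ⟨hc.1.le, le_rfl⟩ h
  · exact ha ⟨le_rfl, hc.2.le⟩ ⟨h.le, hx.2⟩ h

/-- Two distinct points identified by an iterate are separated by a point which is mapped onto a
turning point earlier. -/
theorem exists_hit_of_iterFrom_eq (hF : IsUNDS a b f c) (k : ℕ) :
    ∀ (n : ℕ) (x y : ℝ), x ∈ Icc a b → y ∈ Icc a b → x ≠ y →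
      iterFrom f n k x = iterFrom f n k y →
      ∃ z ∈ uIcc x y, ∃ j < k, iterFrom f n j z = c (n + j) := by
  induction k with
  | zero => exact fun n x y _ _ hne h => (hne h).elim
  | succ k ih =>
    intro n x y hx hy hne h
    by_cases hcn : c n ∈ uIcc x y
    · exact ⟨c n, hcn, 0, k.succ_pos, rfl⟩
    obtain ⟨hcont, hmaps, -, -, hc, hm, ha⟩ := hF.2 n
    have hfne : f n x ≠ f n y := by
      rw [mem_uIcc] at hcn
      have hside : x < c n ∧ y < c n ∨ c n < x ∧ c n < y := by grind
      intro hf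
      rcases hside with ⟨h1, h2⟩ | ⟨h1, h2⟩
      · exact hne (hm.injOn ⟨hx.1, h1.le⟩ ⟨hy.1, h2.le⟩ hf)
      · exact hne (ha.injOn ⟨h1.le, hx.2⟩ ⟨h2.le, hy.2⟩ hf)
    rw [iterFrom_succ', iterFrom_succ'] at h
    obtain ⟨w, hw, j, hj, hjw⟩ := ih (n + 1) _ _ (hmaps hx) (hmaps hy) hfne h
    obtain ⟨z, hz, rfl⟩ := intermediate_value_uIcc (hcont.mono (uIcc_subset_Icc hx hy)) hw
    refine ⟨z, hz, j + 1, by omega, ?_⟩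
    rw [iterFrom_succ', hjw]
    congr 1
    omega

end IsUNDS

/-- `x` and `y` have the same itinerary with respect to the turning points. -/
def SameItinerary (f : ℕ → ℝ → ℝ) (cF : ℕ → ℝ) (g : ℕ → ℝ → ℝ) (cG : ℕ → ℝ)
    (n : ℕ) (x y : ℝ) : Prop :=
  ∀ ℓ : ℕ, (iterFrom f n ℓ x < cF (n + ℓ) ↔ iterFrom g n ℓ y < cG (n + ℓ)) ∧
    (iterFrom f n ℓ x = cF (n + ℓ) ↔ iterFrom g n ℓ y = cG (n + ℓ))

namespace SameItinerary

variable {aF bF aG bG : ℝ} {f g : ℕ → ℝ → ℝ} {cF cG : ℕ → ℝ} {n : ℕ} {x y : ℝ}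

theorem iff_succ : SameItinerary f cF g cG n x y ↔
    ((x < cF n ↔ y < cG n) ∧ (x = cF n ↔ y = cG n)) ∧
      SameItinerary f cF g cG (n + 1) (f n x) (g n y) := by
  constructor
  · refine fun h => ⟨h 0, fun ℓ => ?_⟩
    have := h (ℓ + 1)
    rwa [iterFrom_succ', iterFrom_succ', show n + (ℓ + 1) = n + 1 + ℓ by omega] at this
  · rintro ⟨h0, h⟩ (_ | ℓ)
    · exact h0
    · rw [iterFrom_succ', iterFrom_succ', show n + (ℓ + 1) = n + 1 + ℓ by omega]
      exact h ℓ

/-- Comparison with a point that is eventually mapped onto a turning point is determined by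
itineraries. -/
theorem lt_iff_lt_of_hit (hF : IsUNDS aF bF f cF) (hG : IsUNDS aG bG g cG) (m : ℕ) :
    ∀ (n : ℕ) (w z x y : ℝ), w ∈ Icc aF bF → z ∈ Icc aG bG → x ∈ Icc aF bF → y ∈ Icc aG bG →
      SameItinerary f cF g cG n w z → SameItinerary f cF g cG n x y →
      iterFrom g n m z = cG (n + m) → (w < x ↔ z < y) ∧ (x < w ↔ y < z) := by
  induction m with
  | zero =>
    intro n w z x y _ _ _ _ hwz hxy hz
    have h1 := (hwz 0).2.2 hz
    have h2 := hxy 0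
    simp only [iterFrom, add_zero] at hz h1 h2
    subst hz h1
    grind
  | succ m ih =>
    intro n w z x y hw hz hx hy hwz hxy hhit
    obtain ⟨hwz0, hwz1⟩ := iff_succ.1 hwz
    obtain ⟨hxy0, hxy1⟩ := iff_succ.1 hxy
    rw [iterFrom_succ', show n + (m + 1) = n + 1 + m by omega] at hhit
    obtain ⟨-, hmF, -, -, hcF, hmonF, hantiF⟩ := hF.2 n
    obtain ⟨-, hmG, -, -, hcG, hmonG, hantiG⟩ := hG.2 n
    have key := ih (n + 1) _ _ _ _ (hmF hw) (hmG hz) (hmF hx) (hmG hy) hwz1 hxy1 hhit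
    rcases lt_trichotomy z (cG n) with hz' | hz' | hz'
    · have hw' := hwz0.1.2 hz'
      rcases lt_or_ge y (cG n) with hy' | hy'
      · have hx' := hxy0.1.2 hy'
        rwa [hmonF.lt_iff_lt ⟨hw.1, hw'.le⟩ ⟨hx.1, hx'.le⟩,
          hmonF.lt_iff_lt ⟨hx.1, hx'.le⟩ ⟨hw.1, hw'.le⟩,
          hmonG.lt_iff_lt ⟨hz.1, hz'.le⟩ ⟨hy.1, hy'.le⟩,
          hmonG.lt_iff_lt ⟨hy.1, hy'.le⟩ ⟨hz.1, hz'.le⟩] at key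
      · grind
    · grind
    · have hw' : cF n < w := by grind
      rcases lt_or_ge (cG n) y with hy' | hy'
      · have hx' : cF n < x := by grind
        rw [hantiF.lt_iff_gt ⟨hw'.le, hw.2⟩ ⟨hx'.le, hx.2⟩,
          hantiF.lt_iff_gt ⟨hx'.le, hx.2⟩ ⟨hw'.le, hw.2⟩,
          hantiG.lt_iff_gt ⟨hz'.le, hz.2⟩ ⟨hy'.le, hy.2⟩,
          hantiG.lt_iff_gt ⟨hy'.le, hy.2⟩ ⟨hz'.le, hz.2⟩] at key
        exact key.symm
      · grind

theorem left (hF : IsUNDS aF bF f cF) (hG : IsUNDS aG bG g cG) (n : ℕ) :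
    SameItinerary f cF g cG n aF aG := by
  intro ℓ
  have h1 := (hF.2 (n + ℓ)).2.2.2.2.1.1
  have h2 := (hG.2 (n + ℓ)).2.2.2.2.1.1
  rw [hF.iterFrom_left, hG.iterFrom_left]
  simp [h1, h2, h1.ne, h2.ne]

theorem right (hF : IsUNDS aF bF f cF) (hG : IsUNDS aG bG g cG) (n : ℕ) :
    SameItinerary f cF g cG n bF bG := by
  obtain ⟨-, -, -, hfb, hcF, -⟩ := hF.2 n
  obtain ⟨-, -, -, hgb, hcG, -⟩ := hG.2 n
  rw [iff_succ, hfb, hgb]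
  exact ⟨by simp [hcF.2.not_gt, hcG.2.not_gt, hcF.2.ne', hcG.2.ne'], left hF hG _⟩

theorem exists_of_hit (hF : IsUNDS aF bF f cF) (hG : IsUNDS aG bG g cG)
    (hknead : SameKneading f cF g cG) (m : ℕ) :
    ∀ (n : ℕ) (y : ℝ), y ∈ Icc aG bG → iterFrom g n m y = cG (n + m) →
      ∃ x ∈ Icc aF bF, SameItinerary f cF g cG n x y := by
  induction m with
  | zero =>
    intro n y _ h
    have h : y = cG n := h
    exact ⟨cF n, hF.turning_mem n, h ▸ hknead n⟩
  | succ m ih =>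
    intro n y hy hhit
    by_cases hyc : y = cG n
    · exact ⟨cF n, hF.turning_mem n, hyc ▸ hknead n⟩
    obtain ⟨hcontF, hmF, hfa, hfb, hcF, -⟩ := hF.2 n
    have hmG := (hG.2 n).2.1
    rw [iterFrom_succ', show n + (m + 1) = n + 1 + m by omega] at hhit
    obtain ⟨w, hw, hwy⟩ := ih (n + 1) _ (hmG hy) hhit
    have hlt : w < f n (cF n) :=
      (lt_iff_lt_of_hit hF hG m _ _ _ _ _ hw (hmG hy) (hmF (hF.turning_mem n))
        (hmG (hG.turning_mem n)) hwy (iff_succ.1 (hknead n)).2 hhit).1.2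
        (hG.apply_lt_apply_turning hy hyc)
    rcases lt_or_gt_of_ne hyc with h | h
    · obtain ⟨x, hx, rfl⟩ := intermediate_value_Icc hcF.1.le
        (hcontF.mono (Icc_subset_Icc_right hcF.2.le)) (show w ∈ _ from ⟨hfa.trans_le hw.1, hlt.le⟩)
      have hxc : x ≠ cF n := fun h => hlt.ne (h ▸ rfl)
      refine ⟨x, ⟨hx.1, hx.2.trans hcF.2.le⟩, iff_succ.2 ⟨?_, hwy⟩⟩
      simp [h, hyc, hxc, lt_of_le_of_ne hx.2 hxc]
    · obtain ⟨x, hx, rfl⟩ := intermediate_value_Icc' hcF.2.le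
        (hcontF.mono (Icc_subset_Icc_left hcF.1.le)) (show w ∈ _ from ⟨hfb.trans_le hw.1, hlt.le⟩)
      have hxc : x ≠ cF n := fun h => hlt.ne (h ▸ rfl)
      refine ⟨x, ⟨hcF.1.le.trans hx.1, hx.2⟩, iff_succ.2 ⟨?_, hwy⟩⟩
      simp [hyc, hxc, h.not_gt, hx.1.not_gt]

end SameItinerary

theorem exists_hit_mem_Ioo {a b : ℝ} {f : ℕ → ℝ → ℝ} {c : ℕ → ℝ} {n : ℕ}
    (hdense : Icc a b ⊆ closure (critSet a b f c n)) {u v : ℝ} (hau : a ≤ u) (huv : u < v)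
    (hvb : v ≤ b) : ∃ z ∈ Ioo u v, z ∈ Icc a b ∧ ∃ m, iterFrom f n m z = c (n + m) := by
  obtain ⟨z, hz, hit⟩ := mem_closure_iff.1
    (hdense (show (u + v) / 2 ∈ Icc a b from ⟨by linarith, by linarith⟩)) (Ioo u v) isOpen_Ioo
    ⟨by linarith, by linarith⟩
  exact ⟨z, hz, hit⟩

/-- The order-preserving map matching itineraries, obtained by completing the matching of the
points that are eventually mapped onto turning points. -/
def itineraryMap (aF bF aG bG : ℝ) (f : ℕ → ℝ → ℝ) (cF : ℕ → ℝ) (g : ℕ → ℝ → ℝ) (cG : ℕ → ℝ)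
    (n : ℕ) (x : ℝ) : ℝ :=
  sSup (insert aG {y | (y ∈ Icc aG bG ∧ ∃ m, iterFrom g n m y = cG (n + m)) ∧
    ∃ w ∈ Icc aF bF, w ≤ x ∧ SameItinerary f cF g cG n w y})

section itineraryMap

variable {aF bF aG bG : ℝ} {f g : ℕ → ℝ → ℝ} {cF cG : ℕ → ℝ}

theorem itineraryMap_bddAbove (hG : IsUNDS aG bG g cG) (n : ℕ) (x : ℝ) :
    bG ∈ upperBounds (insert aG {y | (y ∈ Icc aG bG ∧ ∃ m, iterFrom g n m y = cG (n + m)) ∧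
      ∃ w ∈ Icc aF bF, w ≤ x ∧ SameItinerary f cF g cG n w y}) := by
  rintro y (rfl | hy)
  · exact hG.1.le
  · exact hy.1.1.2

theorem itineraryMap_monotone (hG : IsUNDS aG bG g cG) (n : ℕ) :
    Monotone (itineraryMap aF bF aG bG f cF g cG n) := by
  refine fun x y hxy => csSup_le_csSup ⟨bG, itineraryMap_bddAbove hG n y⟩ (insert_nonempty _ _)
    (insert_subset_insert ?_)
  rintro z ⟨hz, w, hw, hwx, hwz⟩
  exact ⟨hz, w, hw, hwx.trans hxy, hwz⟩

theorem itineraryMap_mem (hG : IsUNDS aG bG g cG) (n : ℕ) (x : ℝ) :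
    itineraryMap aF bF aG bG f cF g cG n x ∈ Icc aG bG :=
  ⟨le_csSup ⟨bG, itineraryMap_bddAbove hG n x⟩ (mem_insert _ _),
    csSup_le (insert_nonempty _ _) (itineraryMap_bddAbove hG n x)⟩

variable (hF : IsUNDS aF bF f cF) (hG : IsUNDS aG bG g cG) (hknead : SameKneading f cF g cG)
  (hdense : ∀ n, Icc aG bG ⊆ closure (critSet aG bG g cG n))

include hF hG hknead hdense

theorem itineraryMap_eq {n : ℕ} {x y : ℝ} (hx : x ∈ Icc aF bF) (hy : y ∈ Icc aG bG)
    (hxy : SameItinerary f cF g cG n x y) : itineraryMap aF bF aG bG f cF g cG n x = y := by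
  refine csSup_eq_of_forall_le_of_forall_lt_exists_gt (insert_nonempty _ _) ?_ fun u hu => ?_
  · rintro z (rfl | ⟨⟨hz, m, hm⟩, w, hw, hwx, hwz⟩)
    · exact hy.1
    · by_contra! h
      exact hwx.not_gt ((SameItinerary.lt_iff_lt_of_hit hF hG m n w z x y hw hz hx hy hwz hxy
        hm).2.2 h)
  · rcases lt_or_ge u aG with h | h
    · exact ⟨aG, mem_insert _ _, h⟩
    obtain ⟨z, hz, hzG, m, hm⟩ := exists_hit_mem_Ioo (hdense n) h hu hy.2
    obtain ⟨w, hw, hwz⟩ := SameItinerary.exists_of_hit hF hG hknead m n z hzG hm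
    refine ⟨z, mem_insert_of_mem _ ⟨⟨hzG, m, hm⟩, w, hw, le_of_lt ?_, hwz⟩, hz.1⟩
    exact (SameItinerary.lt_iff_lt_of_hit hF hG m n w z x y hw hzG hx hy hwz hxy hm).1.2 hz.2

theorem exists_itineraryMap_eq {n m : ℕ} {y : ℝ} (hy : y ∈ Icc aG bG)
    (hm : iterFrom g n m y = cG (n + m)) :
    ∃ x ∈ Icc aF bF, itineraryMap aF bF aG bG f cF g cG n x = y ∧
      SameItinerary f cF g cG n x y := by
  obtain ⟨x, hx, hxy⟩ := SameItinerary.exists_of_hit hF hG hknead m n y hy hm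
  exact ⟨x, hx, itineraryMap_eq hF hG hknead hdense hx hy hxy, hxy⟩

theorem itineraryMap_left (n : ℕ) : itineraryMap aF bF aG bG f cF g cG n aF = aG :=
  itineraryMap_eq hF hG hknead hdense (left_mem_Icc.2 hF.1.le) (left_mem_Icc.2 hG.1.le)
    (SameItinerary.left hF hG n)

theorem itineraryMap_right (n : ℕ) : itineraryMap aF bF aG bG f cF g cG n bF = bG :=
  itineraryMap_eq hF hG hknead hdense (right_mem_Icc.2 hF.1.le) (right_mem_Icc.2 hG.1.le)
    (SameItinerary.right hF hG n)

theorem itineraryMap_continuousOn (n : ℕ) :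
    ContinuousOn (itineraryMap aF bF aG bG f cF g cG n) (Icc aF bF) := by
  let φ : Icc aF bF → Icc aG bG := fun x =>
    ⟨_, itineraryMap_mem (aF := aF) (bF := bF) (f := f) (cF := cF) hG n x⟩
  have hmono : Monotone φ := fun x y hxy => itineraryMap_monotone hG n hxy
  have hrange : DenseRange φ := by
    refine Subtype.dense_iff.2 ((hdense n).trans (closure_mono ?_))
    rintro y ⟨hy, m, hm⟩
    obtain ⟨x, hx, hxy, -⟩ := exists_itineraryMap_eq hF hG hknead hdense hy hm
    exact ⟨⟨y, hy⟩, ⟨⟨x, hx⟩, Subtype.ext hxy⟩, rfl⟩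
  exact continuousOn_iff_continuous_domRestrict.2
    (continuous_subtype_val.comp (hmono.continuous_of_denseRange hrange))

theorem itineraryMap_surjOn (n : ℕ) :
    SurjOn (itineraryMap aF bF aG bG f cF g cG n) (Icc aF bF) (Icc aG bG) := by
  have := intermediate_value_Icc hF.1.le (itineraryMap_continuousOn hF hG hknead hdense n)
  rwa [itineraryMap_left hF hG hknead hdense, itineraryMap_right hF hG hknead hdense] at this

/-- Two monotone functions that agree at the endpoints and at the points eventually mapped onto
turning points are equal, provided one of them factors through `itineraryMap`. -/
theorem eqOn_of_monotoneOn_of_eq_of_hit {n : ℕ} {p q : ℝ} {A B k : ℝ → ℝ}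
    (hpq : p ≤ q)
    (hA : ∀ x, A x = k (itineraryMap aF bF aG bG f cF g cG n x))
    (hAc : ContinuousOn A (Icc p q)) (hAm : MonotoneOn A (Icc p q))
    (hBm : MonotoneOn B (Icc p q)) (hABp : A p = B p) (hABq : A q = B q)
    (hAB : ∀ x ∈ Icc p q, ∀ y ∈ Icc aG bG, SameItinerary f cF g cG n x y → A x = B x) :
    EqOn A B (Icc p q) := by
  have hmono := itineraryMap_monotone (aF := aF) (bF := bF) (f := f) (cF := cF) hG n
  have hmem := itineraryMap_mem (aF := aF) (bF := bF) (f := f) (cF := cF) hG n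
  have key : ∀ x ∈ Icc p q, ∀ y ∈ Icc p q, A x < A y → ∃ s ∈ Icc x y, A s = B s := by
    intro x hx y hy hlt
    have hxy : x < y := by
      by_contra! h
      exact (hAm hy hx h).not_gt hlt
    have hh : itineraryMap aF bF aG bG f cF g cG n x < itineraryMap aF bF aG bG f cF g cG n y :=
      lt_of_le_of_ne (hmono hxy.le) fun h => hlt.ne (by rw [hA, hA, h])
    obtain ⟨z, hz, hzG, m, hm⟩ := exists_hit_mem_Ioo (hdense n) (hmem x).1 hh (hmem y).2
    obtain ⟨s, hs, rfl, hsz⟩ := exists_itineraryMap_eq hF hG hknead hdense hzG hm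
    have hxs := (hmono.reflect_lt hz.1).le
    have hsy := (hmono.reflect_lt hz.2).le
    exact ⟨s, ⟨hxs, hsy⟩, hAB s ⟨hx.1.trans hxs, hsy.trans hy.2⟩ _ hzG hsz⟩
  intro x hx
  have hpI : p ∈ Icc p q := left_mem_Icc.2 hpq
  have hqI : q ∈ Icc p q := right_mem_Icc.2 hpq
  rcases lt_trichotomy (A x) (B x) with h | h | h
  · have hB := hBm hx hqI hx.2
    obtain ⟨v, hv1, hv2⟩ := exists_between h
    obtain ⟨y, hy, rfl⟩ := intermediate_value_Icc hx.2
      (hAc.mono (Icc_subset_Icc_left hx.1)) (show v ∈ _ from ⟨hv1.le, by linarith⟩)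
    have hyI : y ∈ Icc p q := ⟨hx.1.trans hy.1, hy.2⟩
    obtain ⟨s, hs, hsE⟩ := key x hx y hyI hv1
    have hsI : s ∈ Icc p q := ⟨hx.1.trans hs.1, hs.2.trans hy.2⟩
    have := hBm hx hsI hs.1
    have := hAm hsI hyI hs.2
    linarith
  · exact h
  · have hB := hBm hpI hx hx.1
    obtain ⟨v, hv1, hv2⟩ := exists_between h
    obtain ⟨y, hy, rfl⟩ := intermediate_value_Icc hx.1
      (hAc.mono (Icc_subset_Icc_right hx.2)) (show v ∈ _ from ⟨by linarith, hv2.le⟩)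
    have hyI : y ∈ Icc p q := ⟨hy.1, hy.2.trans hx.2⟩
    obtain ⟨s, hs, hsE⟩ := key y hyI x hx hv2
    have hsI : s ∈ Icc p q := ⟨hy.1.trans hs.1, hs.2.trans hx.2⟩
    have := hBm hsI hx hs.2
    have := hAm hyI hsI hs.1
    linarith

theorem itineraryMap_semiconj (n : ℕ) {x : ℝ} (hx : x ∈ Icc aF bF) :
    itineraryMap aF bF aG bG f cF g cG (n + 1) (f n x) =
      g n (itineraryMap aF bF aG bG f cF g cG n x) := by
  obtain ⟨-, hmF, -, -, hcF, hmonF, hantiF⟩ := hF.2 n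
  obtain ⟨hcontG, hmG, -, -, hcG, hmonG, hantiG⟩ := hG.2 n
  set h := itineraryMap aF bF aG bG f cF g cG n with hh
  set h' := itineraryMap aF bF aG bG f cF g cG (n + 1) with hh'
  have hmono : Monotone h := itineraryMap_monotone hG n
  have hmono' : Monotone h' := itineraryMap_monotone hG (n + 1)
  have hmem : ∀ x, h x ∈ Icc aG bG := itineraryMap_mem hG n
  have hagree : ∀ x ∈ Icc aF bF, ∀ y ∈ Icc aG bG, SameItinerary f cF g cG n x y →
      g n (h x) = h' (f n x) := by
    intro x hx y hy hxy
    rw [hh, hh', itineraryMap_eq hF hG hknead hdense hx hy hxy,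
      itineraryMap_eq hF hG hknead hdense (hmF hx) (hmG hy) (SameItinerary.iff_succ.1 hxy).2]
  have ha := hagree aF (left_mem_Icc.2 hF.1.le) aG (left_mem_Icc.2 hG.1.le)
    (SameItinerary.left hF hG n)
  have hb := hagree bF (right_mem_Icc.2 hF.1.le) bG (right_mem_Icc.2 hG.1.le)
    (SameItinerary.right hF hG n)
  have hc := hagree _ (hF.turning_mem n) _ (hG.turning_mem n) (hknead n)
  have hhc : h (cF n) = cG n :=
    itineraryMap_eq hF hG hknead hdense (hF.turning_mem n) (hG.turning_mem n) (hknead n)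
  have hcont : ContinuousOn (fun x => g n (h x)) (Icc aF bF) :=
    hcontG.comp (itineraryMap_continuousOn hF hG hknead hdense n) fun x _ => hmem x
  rcases le_total x (cF n) with hxc | hxc
  · refine (eqOn_of_monotoneOn_of_eq_of_hit hF hG hknead hdense (n := n) (k := g n)
      (A := fun x => g n (h x)) (B := fun x => h' (f n x)) hcF.1.le (fun _ => rfl)
      (hcont.mono (Icc_subset_Icc_right hcF.2.le)) ?_ ?_ ha hc
      (fun x hx => hagree x ⟨hx.1, hx.2.trans hcF.2.le⟩) ⟨hx.1, hxc⟩).symm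
    · exact fun x hx y hy hxy => hmonG.monotoneOn ⟨(hmem x).1, hhc ▸ hmono hx.2⟩
        ⟨(hmem y).1, hhc ▸ hmono hy.2⟩ (hmono hxy)
    · exact fun x hx y hy hxy => hmono' (hmonF.monotoneOn hx hy hxy)
  · refine neg_injective (eqOn_of_monotoneOn_of_eq_of_hit hF hG hknead hdense (n := n)
      (k := fun y => -g n y) (A := fun x => -g n (h x)) (B := fun x => -h' (f n x))
      hcF.2.le (fun _ => rfl)
      (hcont.mono (Icc_subset_Icc_left hcF.1.le)).neg ?_ ?_ (congrArg _ hc) (congrArg _ hb)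
      (fun x hx y hy hxy => congrArg _ (hagree x ⟨hcF.1.le.trans hx.1, hx.2⟩ y hy hxy))
      ⟨hxc, hx.2⟩).symm
    · exact fun x hx y hy hxy => neg_le_neg (hantiG.antitoneOn ⟨hhc ▸ hmono hx.1, (hmem x).2⟩
        ⟨hhc ▸ hmono hy.1, (hmem y).2⟩ (hmono hxy))
    · exact fun x hx y hy hxy => neg_le_neg (hmono' (hantiF.antitoneOn hx hy hxy))

end itineraryMap

section Limit

open Filter Topology

variable {a b : ℝ} {f : ℕ → ℝ → ℝ} {c : ℕ → ℝ} {f₀ : ℝ → ℝ} {c₀ : ℝ}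

theorem IsUnimodal.isUNDS (hf₀ : IsUnimodal a b f₀ c₀) :
    IsUNDS a b (fun _ => f₀) (fun _ => c₀) :=
  ⟨hf₀.2.2.2.2.1.1.trans hf₀.2.2.2.2.1.2, fun _ => hf₀⟩

theorem IsUnimodal.iterate_mem (hf₀ : IsUnimodal a b f₀ c₀) (ℓ : ℕ) {x : ℝ}
    (hx : x ∈ Icc a b) : f₀^[ℓ] x ∈ Icc a b :=
  iterFrom_const f₀ 0 ℓ x ▸ hf₀.isUNDS.mapsTo_iterFrom 0 ℓ hx

theorem IsUnimodal.continuousOn_iterate (hf₀ : IsUnimodal a b f₀ c₀) (ℓ : ℕ) :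
    ContinuousOn f₀^[ℓ] (Icc a b) :=
  (hf₀.isUNDS.continuousOn_iterFrom 0 ℓ).congr fun x _ => (iterFrom_const f₀ 0 ℓ x).symm

namespace IsUNDS

variable (hF : IsUNDS a b f c) (hf₀ : IsUnimodal a b f₀ c₀)
  (hconv : TendstoUniformlyOn (fun n => f n) f₀ atTop (Icc a b))

include hF hf₀ hconv

theorem tendsto_turning : Tendsto c atTop (𝓝 c₀) := by
  have hc₀ : c₀ ∈ Icc a b := Ioo_subset_Icc_self hf₀.2.2.2.2.1
  have hlt : ∀ u ∈ Icc a b, u ≠ c₀ → ∀ᶠ n in atTop, f n u < f n c₀ := fun u hu hne =>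
    (hconv.tendsto_at hu).eventually_lt (hconv.tendsto_at hc₀)
      (hf₀.isUNDS.apply_lt_apply_turning (n := 0) hu hne)
  refine tendsto_order.2 ⟨fun u hu => ?_, fun u hu => ?_⟩
  · rcases lt_or_ge u a with h | h
    · exact Eventually.of_forall fun n => h.trans (hF.2 n).2.2.2.2.1.1
    filter_upwards [hlt u ⟨h, hu.le.trans hc₀.2⟩ hu.ne] with n hn
    by_contra! hcn
    exact hn.not_ge ((hF.2 n).2.2.2.2.2.2.antitoneOn ⟨hcn, hu.le.trans hc₀.2⟩
      ⟨hcn.trans hu.le, hc₀.2⟩ hu.le)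
  · rcases lt_or_ge b u with h | h
    · exact Eventually.of_forall fun n => (hF.2 n).2.2.2.2.1.2.trans h
    filter_upwards [hlt u ⟨hc₀.1.trans hu.le, h⟩ hu.ne'] with n hn
    by_contra! hcn
    exact hn.not_ge ((hF.2 n).2.2.2.2.2.1.monotoneOn ⟨hc₀.1, hu.le.trans hcn⟩
      ⟨hc₀.1.trans hu.le, hcn⟩ hu.le)

theorem tendsto_turning_add (m : ℕ) : Tendsto (fun n => c (n + m)) atTop (𝓝 c₀) :=
  (tendsto_add_atTop_iff_nat m).2 (hF.tendsto_turning hf₀ hconv)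

theorem tendstoUniformlyOn_iterFrom (ℓ : ℕ) :
    TendstoUniformlyOn (fun n => iterFrom f n ℓ) f₀^[ℓ] atTop (Icc a b) := by
  rw [Metric.tendstoUniformlyOn_iff]
  induction ℓ with
  | zero => exact fun ε hε => Eventually.of_forall fun n x _ => by simpa [iterFrom] using hε
  | succ ℓ ih =>
    intro ε hε
    obtain ⟨δ, hδ, huc⟩ := Metric.uniformContinuousOn_iff.1
      (isCompact_Icc.uniformContinuousOn_of_continuous hf₀.1) (ε / 2) (half_pos hε)
    have hshift := (tendsto_add_atTop_nat ℓ).eventually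
      (Metric.tendstoUniformlyOn_iff.1 hconv (ε / 2) (half_pos hε))
    filter_upwards [ih δ hδ, hshift] with n h1 h2 x hx
    have hmem := hF.mapsTo_iterFrom n ℓ hx
    rw [iterFrom, Function.iterate_succ_apply']
    calc _ ≤ _ := dist_triangle _ (f₀ (iterFrom f n ℓ x)) _
      _ < ε / 2 + ε / 2 := add_lt_add (huc _ (hf₀.iterate_mem ℓ hx) _ hmem (h1 x hx)) (h2 _ hmem)
      _ = ε := add_halves ε

theorem tendsto_iterFrom_turning (k j : ℕ) :
    Tendsto (fun n => iterFrom f (n + k) j (c (n + k))) atTop (𝓝 (f₀^[j] c₀)) := by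
  have hc₀ : c₀ ∈ Icc a b := Ioo_subset_Icc_self hf₀.2.2.2.2.1
  have h := (hF.tendstoUniformlyOn_iterFrom hf₀ hconv j).tendsto_comp
    ((hf₀.continuousOn_iterate j) c₀ hc₀)
    (tendsto_nhdsWithin_iff.2 ⟨hF.tendsto_turning hf₀ hconv, Eventually.of_forall hF.turning_mem⟩)
  exact h.comp (tendsto_add_atTop_nat k)

/-- Points mapped onto turning points at different bounded times are uniformly separated. -/
theorem eventually_separated_of_lt (hper : ∀ m : ℕ, 1 ≤ m → f₀^[m] c₀ ≠ c₀) {k m : ℕ}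
    (hkm : k < m) : ∀ᶠ δ in 𝓝[>] (0 : ℝ), ∀ᶠ n in atTop, ∀ x ∈ Icc a b, ∀ y ∈ Icc a b,
      iterFrom f n k x = c (n + k) → iterFrom f n m y = c (n + m) → δ ≤ |x - y| := by
  set η := dist (f₀^[m - k] c₀) c₀ with hη
  have hηpos : 0 < η := dist_pos.2 (hper _ (by omega))
  obtain ⟨δ, hδ, huc⟩ := Metric.uniformContinuousOn_iff.1
    (isCompact_Icc.uniformContinuousOn_of_continuous (hf₀.continuousOn_iterate m)) (η / 4)
    (by positivity)
  have hdist : ∀ᶠ n in atTop, 3 * η / 4 < dist (iterFrom f (n + k) (m - k) (c (n + k))) (c (n + m)) :=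
    ((hF.tendsto_iterFrom_turning hf₀ hconv k (m - k)).dist
      (hF.tendsto_turning_add hf₀ hconv m)).eventually_const_lt (by linarith)
  have hunif := Metric.tendstoUniformlyOn_iff.1 (hF.tendstoUniformlyOn_iterFrom hf₀ hconv m) (η / 4)
    (by positivity)
  filter_upwards [Ioc_mem_nhdsGT hδ] with δ' hδ'
  filter_upwards [hdist, hunif] with n h1 h2 x hx y hy hxk hym
  by_contra! hlt
  have h3 := huc x hx y hy (lt_of_lt_of_le hlt hδ'.2)
  have h4 := h2 x hx
  have h5 := h2 y hy
  rw [← hxk, ← iterFrom_add, Nat.add_sub_cancel' hkm.le, ← hym] at h1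
  have h6 := dist_triangle4 (iterFrom f n m x) (f₀^[m] x) (f₀^[m] y) (iterFrom f n m y)
  rw [dist_comm] at h4
  linarith

/-- Points mapped onto turning points within a bounded time are uniformly separated. -/
theorem exists_separated (hper : ∀ m : ℕ, 1 ≤ m → f₀^[m] c₀ ≠ c₀) (L : ℕ) :
    ∃ δ > 0, ∀ᶠ n in atTop, ∀ x ∈ Icc a b, ∀ y ∈ Icc a b, x < y →
      (∃ k ≤ L, iterFrom f n k x = c (n + k)) → (∃ m ≤ L, iterFrom f n m y = c (n + m)) →
      δ ≤ y - x := by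
  have hall : ∀ᶠ δ in 𝓝[>] (0 : ℝ), ∀ m ∈ Finset.range (L + 1), ∀ k ∈ Finset.range m,
      ∀ᶠ n in atTop, ∀ x ∈ Icc a b, ∀ y ∈ Icc a b,
        iterFrom f n k x = c (n + k) → iterFrom f n m y = c (n + m) → δ ≤ |x - y| := by
    simp only [eventually_all_finset]
    exact fun m _ k hk =>
      hF.eventually_separated_of_lt hf₀ hconv hper (Finset.mem_range.1 hk)
  obtain ⟨δ, hδ, hδpos⟩ := (hall.and self_mem_nhdsWithin).exists
  refine ⟨δ, hδpos, ?_⟩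
  simp only [← eventually_all_finset] at hδ
  filter_upwards [hδ] with n hn x hx y hy hxy ⟨k, hk, hxk⟩ ⟨m, hm, hym⟩
  simp only [Finset.mem_range] at hn
  rcases lt_trichotomy k m with h | rfl | h
  · have := hn m (by omega) k h x hx y hy hxk hym
    rwa [abs_sub_comm, abs_of_pos (sub_pos.2 hxy)] at this
  · obtain ⟨z, hz, j, hj, hzj⟩ :=
      hF.exists_hit_of_iterFrom_eq k n x y hx hy hxy.ne (hxk.trans hym.symm)
    rw [uIcc_of_le hxy.le] at hz
    have h1 := hn k (by omega) j hj z ⟨hx.1.trans hz.1, hz.2.trans hy.2⟩ x hx hzj hxk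
    rw [abs_of_nonneg (sub_nonneg.2 hz.1)] at h1
    linarith [hz.2]
  · have := hn k (by omega) m h y hy x hx hym hxk
    rwa [abs_of_pos (sub_pos.2 hxy)] at this

theorem eventually_exists_hit_mem_Ioo (hdense : Icc a b ⊆ closure (critSetMap a b f₀ c₀))
    {u v : ℝ} (hau : a ≤ u) (huv : u < v) (hvb : v ≤ b) :
    ∃ m, ∀ᶠ n in atTop, ∃ z ∈ Ioo u v, iterFrom f n m z = c (n + m) := by
  have hex : ∃ ℓ, ∃ z ∈ Ioo u v, f₀^[ℓ] z = c₀ := by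
    obtain ⟨z, hz, -, ℓ, hℓ⟩ := mem_closure_iff.1
      (hdense (show (u + v) / 2 ∈ Icc a b from ⟨by linarith, by linarith⟩)) (Ioo u v) isOpen_Ioo
      ⟨by linarith, by linarith⟩
    exact ⟨ℓ, z, hz, hℓ⟩
  classical
  obtain ⟨p, hp, hpc⟩ := Nat.find_spec hex
  set ℓ := Nat.find hex
  obtain ⟨r, hur, hrp⟩ := exists_between hp.1
  obtain ⟨s, hps, hsv⟩ := exists_between hp.2
  have hsub : Icc r s ⊆ Icc a b := Icc_subset_Icc (by linarith) (by linarith)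
  have hinj : InjOn f₀^[ℓ] (Icc r s) := by
    intro x hx y hy hxy
    by_contra hne
    obtain ⟨z, hz, j, hj, hzj⟩ := hf₀.isUNDS.exists_hit_of_iterFrom_eq ℓ 0 x y (hsub hx) (hsub hy)
      hne (by simpa only [iterFrom_const] using hxy)
    rw [iterFrom_const] at hzj
    have hz' := uIcc_subset_Icc hx hy hz
    exact Nat.find_min hex hj ⟨z, ⟨by linarith [hz'.1], by linarith [hz'.2]⟩, hzj⟩
  have hr : r ∈ Icc r s := left_mem_Icc.2 (hrp.trans hps).le
  have hs : s ∈ Icc r s := right_mem_Icc.2 (hrp.trans hps).le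
  have hp' : p ∈ Icc r s := ⟨hrp.le, hps.le⟩
  have hunif := hF.tendstoUniformlyOn_iterFrom hf₀ hconv ℓ
  have hlimr := hunif.tendsto_at (hsub hr)
  have hlims := hunif.tendsto_at (hsub hs)
  have hlimc := hF.tendsto_turning_add hf₀ hconv ℓ
  refine ⟨ℓ, ?_⟩
  rcases ((hf₀.continuousOn_iterate ℓ).mono hsub).strictMonoOn_of_injOn_Icc'
    (hrp.trans hps).le hinj with hm | hm
  · filter_upwards [hlimr.eventually_lt hlimc (hpc ▸ hm hr hp' hrp),
      hlimc.eventually_lt hlims (hpc ▸ hm hp' hs hps)] with n h1 h2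
    obtain ⟨z, hz, hzc⟩ := intermediate_value_Icc (hrp.trans hps).le
      ((hF.continuousOn_iterFrom n ℓ).mono hsub) ⟨h1.le, h2.le⟩
    exact ⟨z, ⟨hur.trans_le hz.1, hz.2.trans_lt hsv⟩, hzc⟩
  · filter_upwards [hlimc.eventually_lt hlimr (hpc ▸ hm hr hp' hrp),
      hlims.eventually_lt hlimc (hpc ▸ hm hp' hs hps)] with n h1 h2
    obtain ⟨z, hz, hzc⟩ := intermediate_value_Icc' (hrp.trans hps).le
      ((hF.continuousOn_iterFrom n ℓ).mono hsub) ⟨h2.le, h1.le⟩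
    exact ⟨z, ⟨hur.trans_le hz.1, hz.2.trans_lt hsv⟩, hzc⟩

/-- For large `n`, the points mapped onto turning points within a bounded time are
`ε`-dense. -/
theorem exists_mesh (hdense : Icc a b ⊆ closure (critSetMap a b f₀ c₀)) {ε : ℝ} (hε : 0 < ε) :
    ∃ L, ∀ᶠ n in atTop, ∀ u, a ≤ u → u + ε ≤ b →
      ∃ z ∈ Ioo u (u + ε), ∃ m ≤ L, iterFrom f n m z = c (n + m) := by
  have hε2 : 0 < ε / 2 := half_pos hε
  have hcell : ∀ i : ℕ, ∀ᶠ L in atTop, ∀ᶠ n in atTop, a + (i + 1) * (ε / 2) ≤ b →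
      ∃ z ∈ Ioo (a + i * (ε / 2)) (a + (i + 1) * (ε / 2)),
        ∃ m ≤ L, iterFrom f n m z = c (n + m) := by
    intro i
    by_cases hi : a + (i + 1) * (ε / 2) ≤ b
    · obtain ⟨m, hm⟩ := hF.eventually_exists_hit_mem_Ioo hf₀ hconv hdense
        (u := a + i * (ε / 2)) (v := a + (i + 1) * (ε / 2))
        (le_add_of_nonneg_right (by positivity)) (by linarith) hi
      filter_upwards [eventually_ge_atTop m] with L hL
      filter_upwards [hm] with n ⟨z, hz, hzm⟩ _
      exact ⟨z, hz, m, hL, hzm⟩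
    · exact Eventually.of_forall fun _ => Eventually.of_forall fun _ h => (hi h).elim
  obtain ⟨L, hL⟩ := ((eventually_all_finset (Finset.range (⌈(b - a) / (ε / 2)⌉₊ + 1))).2
    fun i _ => hcell i).exists
  refine ⟨L, ?_⟩
  filter_upwards [(eventually_all_finset _).2 hL] with n hn u hau hub
  have hnonneg : 0 ≤ (u - a) / (ε / 2) := div_nonneg (sub_nonneg.2 hau) hε2.le
  have hle : (u - a) / (ε / 2) ≤ ⌈(u - a) / (ε / 2)⌉₊ := Nat.le_ceil _
  have hlt : (⌈(u - a) / (ε / 2)⌉₊ : ℝ) < (u - a) / (ε / 2) + 1 := Nat.ceil_lt_add_one hnonneg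
  have hmono : ⌈(u - a) / (ε / 2)⌉₊ ≤ ⌈(b - a) / (ε / 2)⌉₊ :=
    Nat.ceil_mono (div_le_div_of_nonneg_right (by linarith) hε2.le)
  have hi := hn ⌈(u - a) / (ε / 2)⌉₊ (Finset.mem_range.2 (by omega))
  rw [div_le_iff₀ hε2] at hle
  rw [← sub_lt_iff_lt_add, lt_div_iff₀ hε2] at hlt
  obtain ⟨z, hz, hzm⟩ := hi (by linarith)
  exact ⟨z, ⟨by linarith [hz.1], by linarith [hz.2]⟩, hzm⟩

end IsUNDS

end Limit

/-- Uniform separation on one side and density on the other control the modulus of continuity of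
`itineraryMap`. -/
theorem abs_itineraryMap_sub_lt {aF bF aG bG : ℝ} {f g : ℕ → ℝ → ℝ} {cF cG : ℕ → ℝ}
    (hF : IsUNDS aF bF f cF) (hG : IsUNDS aG bG g cG) (hknead : SameKneading f cF g cG)
    (hdense : ∀ n, Icc aG bG ⊆ closure (critSet aG bG g cG n)) {n L : ℕ} {δ ε : ℝ} (hε : 0 < ε)
    (hsep : ∀ x ∈ Icc aF bF, ∀ y ∈ Icc aF bF, x < y →
      (∃ k ≤ L, iterFrom f n k x = cF (n + k)) → (∃ m ≤ L, iterFrom f n m y = cF (n + m)) →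
      δ ≤ y - x)
    (hmesh : ∀ u, aG ≤ u → u + ε / 2 ≤ bG →
      ∃ z ∈ Ioo u (u + ε / 2), ∃ m ≤ L, iterFrom g n m z = cG (n + m))
    {x y : ℝ} (hxy : |x - y| < δ) :
    |itineraryMap aF bF aG bG f cF g cG n x - itineraryMap aF bF aG bG f cF g cG n y| < ε := by
  wlog hle : x ≤ y generalizing x y
  · rw [abs_sub_comm] at hxy ⊢
    exact this hxy (le_of_not_ge hle)
  have hmono := itineraryMap_monotone (aF := aF) (bF := bF) (f := f) (cF := cF) hG n
  have hmem := itineraryMap_mem (aF := aF) (bF := bF) (f := f) (cF := cF) hG n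
  rw [abs_sub_comm, abs_of_nonneg (sub_nonneg.2 (hmono hle))]
  rw [abs_sub_comm, abs_of_nonneg (sub_nonneg.2 hle)] at hxy
  by_contra! hge
  have hx := (hmem x).1
  have hy := (hmem y).2
  obtain ⟨z, hz, k, hk, hzk⟩ := hmesh _ hx (by linarith)
  obtain ⟨w, hw, m, hm, hwm⟩ := hmesh (itineraryMap aF bF aG bG f cF g cG n x + ε / 2)
    (by linarith) (by linarith)
  obtain ⟨s, hs, rfl, hsz⟩ := exists_itineraryMap_eq hF hG hknead hdense
    ⟨hx.trans hz.1.le, by linarith [hz.2]⟩ hzk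
  obtain ⟨t, ht, rfl, htw⟩ := exists_itineraryMap_eq hF hG hknead hdense
    ⟨by linarith [hw.1], by linarith [hw.2]⟩ hwm
  have hst : s < t := hmono.reflect_lt (hz.2.trans hw.1)
  have hxs : x < s := hmono.reflect_lt hz.1
  have hty : t < y := hmono.reflect_lt (hw.2.trans_le (by linarith))
  have := hsep s hs t ht hst ⟨k, hk, (hsz k).2.2 hzk⟩ ⟨m, hm, (htw m).2.2 hwm⟩
  linarith

/-- Semi-conjugacy variant of the main theorem: if `(J^ℱ,(f n))` and `(J^𝒢,(g n))`
have the same kneading sequence, `(J^𝒢,(g n))` satisfies the limit property, and there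
is a unimodal map `f₀ : J^ℱ → J^ℱ` with non-periodic turning point, dense critical set
`𝒞(f₀)`, to which `f n` converges uniformly, then the systems are topologically
semi-conjugate via an equicontinuous family of order-preserving continuous
surjections. -/
theorem exists_semiconjugacy_of_limitProperty
    (aF bF aG bG : ℝ) (f g : ℕ → ℝ → ℝ) (cF cG : ℕ → ℝ)
    (hF : IsUNDS aF bF f cF) (hG : IsUNDS aG bG g cG)
    (hknead : SameKneading f cF g cG)
    (hLG : LimitProperty aG bG g cG)
    (f₀ : ℝ → ℝ) (cf₀ : ℝ)
    (hf₀ : IsUnimodal aF bF f₀ cf₀)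
    (hf₀per : ∀ m : ℕ, 1 ≤ m → f₀^[m] cf₀ ≠ cf₀)
    (hf₀dense : Icc aF bF ⊆ closure (critSetMap aF bF f₀ cf₀))
    (hconv : TendstoUniformlyOn (fun n => f n) f₀ Filter.atTop (Icc aF bF)) :
    ∃ h : ℕ → ℝ → ℝ,
      (∀ n, MonotoneOn (h n) (Icc aF bF)) ∧
      (∀ n, ContinuousOn (h n) (Icc aF bF)) ∧
      (∀ n, MapsTo (h n) (Icc aF bF) (Icc aG bG)) ∧
      (∀ n, SurjOn (h n) (Icc aF bF) (Icc aG bG)) ∧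
      (∀ ε > (0:ℝ), ∃ δ > (0:ℝ), ∀ n, ∀ x ∈ Icc aF bF, ∀ y ∈ Icc aF bF,
        |x - y| < δ → |h n x - h n y| < ε) ∧
      (∀ n, ∀ x ∈ Icc aF bF, h (n + 1) (f n x) = g n (h n x)) := by
  obtain ⟨g₀, cg₀, hg₀, -, hconvG, hdense, hdense₀⟩ := hLG
  have hcont := itineraryMap_continuousOn hF hG hknead hdense
  refine ⟨itineraryMap aF bF aG bG f cF g cG, fun n => (itineraryMap_monotone hG n).monotoneOn _,
    hcont, fun n x _ => itineraryMap_mem hG n x, itineraryMap_surjOn hF hG hknead hdense,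
    fun ε hε => ?_, fun n x hx => itineraryMap_semiconj hF hG hknead hdense n hx⟩
  obtain ⟨L, hmesh⟩ := hG.exists_mesh hg₀ hconvG hdense₀ (half_pos hε)
  obtain ⟨δ, hδ, hsep⟩ := hF.exists_separated hf₀ hconv hf₀per L
  obtain ⟨N, hN⟩ := Filter.eventually_atTop.1 (hmesh.and hsep)
  have hsmall : ∀ n, ∀ᶠ δ' in nhdsWithin (0 : ℝ) (Ioi 0), ∀ x ∈ Icc aF bF, ∀ y ∈ Icc aF bF,
      |x - y| < δ' → |itineraryMap aF bF aG bG f cF g cG n x -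
        itineraryMap aF bF aG bG f cF g cG n y| < ε := by
    intro n
    obtain ⟨δ', hδ', huc⟩ := Metric.uniformContinuousOn_iff.1
      (isCompact_Icc.uniformContinuousOn_of_continuous (hcont n)) ε hε
    filter_upwards [Ioc_mem_nhdsGT hδ'] with d hd x hx y hy hxy
    exact huc x hx y hy (lt_of_lt_of_le hxy hd.2)
  obtain ⟨δ', hδ', hmem⟩ := (((Filter.eventually_all_finset (Finset.range N)).2
    fun n _ => hsmall n).and (Ioc_mem_nhdsGT hδ)).exists
  refine ⟨δ', hmem.1, fun n x hx y hy hxy => ?_⟩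
  rcases lt_or_ge n N with hn | hn
  · exact hδ' n (Finset.mem_range.2 hn) x hx y hy hxy
  · exact abs_itineraryMap_sub_lt hF hG hknead hdense hε (hN n hn).2 (hN n hn).1
      (hxy.trans_le hmem.2)
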